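/- arXiv:0910.3034 — 8 statements merged into one kernel-verified Lean document; each statement's English description precedes it below -/
import Mathlib

section
/- For every z ∈ ℂ, the Hilger imaginary part converges to the ordinary imaginary part as the graininess tends to zero from above: the function μ ↦ Arg(1 + μz)/μ tends to Im(z) as μ → 0⁺, where Arg denotes the principal argument with values in (-π, π]. -/
/-- The Hilger imaginary part Im_μ(z) = Arg(1 + μz)/μ tends to Im(z) as μ → 0⁺,
where Arg is the principal argument with values in (-π, π]. -/
theorem hilger_imaginary_part_tendsto_im (z : ℂ) :
    Filter.Tendsto (fun μ : ℝ => Complex.arg (1 + (μ : ℂ) * z) / μ)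
      (nhdsWithin 0 (Set.Ioi 0)) (nhds z.im) := by
  have h_inner : HasDerivAt (fun μ : ℝ => 1 + (μ : ℂ) * z) z 0 := by
    simpa using ((hasDerivAt_id (0 : ℝ)).ofReal_comp.mul_const z).const_add 1
  have h_log : HasDerivAt (fun μ : ℝ => Complex.log (1 + (μ : ℂ) * z)) z 0 := by
    simpa using h_inner.clog_real (by simp)
  have h_arg : HasDerivAt (fun μ : ℝ => Complex.arg (1 + (μ : ℂ) * z)) z.im 0 := by
    simpa [Function.comp_def, Complex.log_im] using
      Complex.imCLM.hasFDerivAt.comp_hasDerivAt (0 : ℝ) h_log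
  simpa [div_eq_inv_mul] using h_arg.tendsto_slope_zero_right
end

section
/- (Controllability Gramian criterion, continuous case.) Let A : ℝ → ℝ^{n×n} and B : ℝ → ℝ^{n×m} be continuous, and let Φ_A be the state transition matrix of A. Fix t₀ < t_f. Then the system x'(t) = A(t)x(t) + B(t)u(t) is controllable on [t₀, t_f] — i.e., for every x₀, x_f ∈ ℝⁿ there exist a continuous input u : ℝ → ℝᵐ and a differentiable x : ℝ → ℝⁿ with x'(t) = A(t)x(t) + B(t)u(t) for all t ∈ [t₀, t_f], x(t₀) = x₀ and x(t_f) = x_f — if and only if the n×n controllability Gramian matrix G_C(t₀, t_f) = ∫_{t₀}^{t_f} Φ_A(t₀, s) B(s) B(s)ᵀ Φ_A(t₀, s)ᵀ ds is invertible. -/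
open MeasureTheory Matrix

theorem HasDerivAt.matrix_mulVec_apply {ι κ : Type*} [Fintype κ]
    {P : ℝ → Matrix ι κ ℝ} {P' : Matrix ι κ ℝ} {x : ℝ → κ → ℝ} {x' : κ → ℝ} {t : ℝ}
    (hP : ∀ i j, HasDerivAt (fun τ => P τ i j) (P' i j) t)
    (hx : ∀ j, HasDerivAt (fun τ => x τ j) (x' j) t) (i : ι) :
    HasDerivAt (fun τ => (P τ *ᵥ x τ) i) ((P' *ᵥ x t + P t *ᵥ x') i) t := by
  simp only [Matrix.mulVec, dotProduct, Pi.add_apply, ← Finset.sum_add_distrib]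
  exact HasDerivAt.fun_sum fun j _ => (hP i j).mul (hx j)

section

attribute [local instance] Matrix.linftyOpNormedRing Matrix.linftyOpNormedAlgebra

theorem Matrix.hasDerivAt_apply_of_mul_eq_one {ι : Type*} [Fintype ι] [DecidableEq ι]
    {M N : ℝ → Matrix ι ι ℝ} {M' : Matrix ι ι ℝ} {t : ℝ}
    (hM : ∀ i j, HasDerivAt (fun τ => M τ i j) (M' i j) t)
    (hMN : ∀ τ, M τ * N τ = 1) (i j : ι) :
    HasDerivAt (fun τ => N τ i j) ((-(N t * M' * N t)) i j) t := by
  have hNM : ∀ τ, N τ * M τ = 1 := fun τ => mul_eq_one_comm.mp (hMN τ)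
  have hM₁ : HasDerivAt M M' t := hasDerivAt_pi.2 fun i => hasDerivAt_pi.2 fun j => hM i j
  let U : ℝ → (Matrix ι ι ℝ)ˣ := fun τ => ⟨M τ, N τ, hMN τ, hNM τ⟩
  have hN : N = fun τ => Ring.inverse (M τ) :=
    funext fun τ => (Ring.inverse_unit (U τ)).symm
  have hinv : HasFDerivAt Ring.inverse (-ContinuousLinearMap.mulLeftRight ℝ _ (N t) (N t)) (M t) :=
    hasFDerivAt_ringInverse (𝕜 := ℝ) (U t)
  have hN₁ : HasDerivAt N (-(N t * M' * N t)) t := by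
    rw [hN] at hinv ⊢
    exact hinv.comp_hasDerivAt t hM₁
  exact hasDerivAt_pi.1 (hasDerivAt_pi.1 hN₁ i) j

end

theorem Matrix.dotProduct_mul_transpose_mulVec {ι κ : Type*} [Fintype ι] [Fintype κ]
    (Q : Matrix ι κ ℝ) (w : ι → ℝ) :
    w ⬝ᵥ ((Q * Qᵀ) *ᵥ w) = (w ᵥ* Q) ⬝ᵥ (w ᵥ* Q) := by
  rw [← Matrix.mulVec_mulVec, Matrix.dotProduct_mulVec, Matrix.mulVec_transpose]

theorem Matrix.of_integral_mulVec {ι κ : Type*} [Fintype κ] {F : ℝ → Matrix ι κ ℝ}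
    (hF : Continuous F) (a b : ℝ) (v : κ → ℝ) (i : ι) :
    ((Matrix.of fun i j => ∫ s in a..b, F s i j) *ᵥ v) i = ∫ s in a..b, (F s *ᵥ v) i := by
  simp only [Matrix.mulVec, dotProduct, Matrix.of_apply]
  rw [intervalIntegral.integral_finsetSum]
  · simp only [intervalIntegral.integral_mul_const]
  · exact fun j _ => ((hF.matrix_elem i j).mul continuous_const).intervalIntegrable _ _

/-- A vector in the kernel of the Gramian `∫ Q Qᵀ` annihilates `Q` on the whole interval. -/
theorem Matrix.vecMul_eq_zero_of_gramian_mulVec_eq_zero {ι κ : Type*} [Fintype ι] [Fintype κ]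
    {Q : ℝ → Matrix ι κ ℝ} (hQ : Continuous Q) {a b : ℝ} (hab : a < b) {w : ι → ℝ}
    (hw : (Matrix.of fun i j => ∫ s in a..b, (Q s * (Q s)ᵀ) i j) *ᵥ w = 0) :
    ∀ s ∈ Set.Icc a b, w ᵥ* Q s = 0 := by
  have hF : Continuous fun s => Q s * (Q s)ᵀ := hQ.matrix_mul hQ.matrix_transpose
  have hint : ∫ s in a..b, (w ᵥ* Q s) ⬝ᵥ (w ᵥ* Q s) = 0 := by
    simp only [← Matrix.dotProduct_mul_transpose_mulVec]
    simp only [dotProduct]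
    rw [intervalIntegral.integral_finsetSum]
    · simp only [intervalIntegral.integral_const_mul, ← Matrix.of_integral_mulVec hF, hw]
      simp
    · exact fun i _ => (continuous_const.mul
        ((continuous_apply i).comp (hF.matrix_mulVec continuous_const))).intervalIntegrable _ _
  have hcont : Continuous fun s => (w ᵥ* Q s) ⬝ᵥ (w ᵥ* Q s) :=
    (continuous_const.matrix_vecMul hQ).dotProduct (continuous_const.matrix_vecMul hQ)
  have hnonneg : ∀ v : κ → ℝ, 0 ≤ v ⬝ᵥ v := fun v =>
    Finset.sum_nonneg fun k _ => mul_self_nonneg (v k)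
  intro s hs
  by_contra hne
  have hpos : 0 < (w ᵥ* Q s) ⬝ᵥ (w ᵥ* Q s) :=
    (hnonneg _).lt_of_ne' fun h0 => hne (dotProduct_self_eq_zero.1 h0)
  exact (intervalIntegral.integral_pos hab hcont.continuousOn (fun x _ => hnonneg _)
    ⟨s, hs, hpos⟩).ne' hint

/-- Controllability Gramian criterion (continuous case): the system
x' = A(t)x + B(t)u is controllable on [t₀, t_f] iff the controllability Gramian
G_C(t₀,t_f) = ∫_{t₀}^{t_f} Φ_A(t₀,s) B(s) B(s)ᵀ Φ_A(t₀,s)ᵀ ds is invertible. -/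
theorem controllability_gramian_criterion_continuous {n m : ℕ}
    (A : ℝ → Matrix (Fin n) (Fin n) ℝ) (B : ℝ → Matrix (Fin n) (Fin m) ℝ)
    (hA : ∀ i j, Continuous fun t => A t i j)
    (hB : ∀ i j, Continuous fun t => B t i j)
    (Φ : ℝ → ℝ → Matrix (Fin n) (Fin n) ℝ)
    (hΦ0 : ∀ s : ℝ, Φ s s = 1)
    (hΦderiv : ∀ s t : ℝ, ∀ i j, HasDerivAt (fun τ => Φ τ s i j) ((A t * Φ t s) i j) t)
    (hΦmul : ∀ t s r : ℝ, Φ t s * Φ s r = Φ t r)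
    (hΦinv : ∀ t s : ℝ, Φ t s * Φ s t = 1)
    (t₀ tf : ℝ) (h : t₀ < tf) :
    (∀ x₀ xf : Fin n → ℝ, ∃ u : ℝ → Fin m → ℝ, Continuous u ∧
      ∃ x : ℝ → Fin n → ℝ,
        (∀ t ∈ Set.Icc t₀ tf, ∀ i, HasDerivAt (fun τ => x τ i)
          ((A t).mulVec (x t) i + (B t).mulVec (u t) i) t) ∧
        x t₀ = x₀ ∧ x tf = xf) ↔
    IsUnit ((Matrix.of fun i j =>
      ∫ s in t₀..tf, (Φ t₀ s * B s * (B s)ᵀ * (Φ t₀ s)ᵀ) i j) : Matrix (Fin n) (Fin n) ℝ) := by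
  have hN : ∀ t i j, HasDerivAt (fun s => Φ t₀ s i j) ((-(Φ t₀ t * A t)) i j) t := by
    intro t i j
    have := Matrix.hasDerivAt_apply_of_mul_eq_one (hΦderiv t₀ t) (fun τ => hΦinv τ t₀) i j
    rwa [Matrix.mul_assoc, Matrix.mul_assoc (A t), hΦinv, Matrix.mul_one] at this
  have hNcont : Continuous fun s => Φ t₀ s := continuous_matrix fun i j =>
    continuous_iff_continuousAt.2 fun t => (hN t i j).continuousAt
  have hQ : Continuous fun s => Φ t₀ s * B s := hNcont.matrix_mul (continuous_matrix hB)
  have hGram : ∀ s, Φ t₀ s * B s * (B s)ᵀ * (Φ t₀ s)ᵀ = (Φ t₀ s * B s) * (Φ t₀ s * B s)ᵀ := by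
    intro s
    rw [Matrix.transpose_mul, Matrix.mul_assoc (Φ t₀ s * B s)]
  simp only [hGram]
  set G : Matrix (Fin n) (Fin n) ℝ := Matrix.of fun i j =>
    ∫ s in t₀..tf, ((Φ t₀ s * B s) * (Φ t₀ s * B s)ᵀ) i j with hG
  constructor
  · intro hctrl
    rw [Matrix.isUnit_iff_isUnit_det, isUnit_iff_ne_zero]
    intro hdet
    obtain ⟨w, hw0, hw⟩ := Matrix.exists_mulVec_eq_zero_iff.2 hdet
    have hker := Matrix.vecMul_eq_zero_of_gramian_mulVec_eq_zero hQ h hw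
    obtain ⟨u, -, x, hx, hx₀, hxf⟩ := hctrl w 0
    have hz : ∀ t ∈ Set.Icc t₀ tf, HasDerivAt (fun τ => w ⬝ᵥ (Φ t₀ τ *ᵥ x τ)) 0 t := by
      intro t ht
      have hy := HasDerivAt.matrix_mulVec_apply (hN t)
        (x' := A t *ᵥ x t + B t *ᵥ u t) (hx t ht)
      have hsum : HasDerivAt (fun τ => w ⬝ᵥ (Φ t₀ τ *ᵥ x τ)) _ t :=
        HasDerivAt.fun_sum fun i _ => (hy i).const_mul (w i)
      refine hsum.congr_deriv ?_
      change w ⬝ᵥ (-(Φ t₀ t * A t) *ᵥ x t + Φ t₀ t *ᵥ (A t *ᵥ x t + B t *ᵥ u t)) = 0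
      rw [Matrix.mulVec_add, Matrix.mulVec_mulVec, Matrix.mulVec_mulVec, Matrix.neg_mulVec,
        neg_add_cancel_left, Matrix.dotProduct_mulVec, hker t ht, zero_dotProduct]
    have hconst := constant_of_has_deriv_right_zero
      (fun t ht => (hz t ht).continuousAt.continuousWithinAt)
      (fun t ht => (hz t (Set.Ico_subset_Icc_self ht)).hasDerivWithinAt) tf
      (Set.right_mem_Icc.2 h.le)
    simp only [hx₀, hxf, hΦ0, Matrix.mulVec_zero, dotProduct_zero, Matrix.one_mulVec] at hconst
    exact hw0 (dotProduct_self_eq_zero.1 hconst.symm)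
  · intro hunit x₀ xf
    let v : Fin n → ℝ := G⁻¹ *ᵥ (Φ t₀ tf *ᵥ xf - x₀)
    have hGv : G *ᵥ v = Φ t₀ tf *ᵥ xf - x₀ := by
      rw [Matrix.mulVec_mulVec, Matrix.mul_nonsing_inv _ ((Matrix.isUnit_iff_isUnit_det _).1 hunit),
        Matrix.one_mulVec]
    let u : ℝ → Fin m → ℝ := fun s => (Φ t₀ s * B s)ᵀ *ᵥ v
    have hu : Continuous u := hQ.matrix_transpose.matrix_mulVec continuous_const
    let y : ℝ → Fin n → ℝ := fun t i => x₀ i + ∫ s in t₀..t, ((Φ t₀ s * B s) *ᵥ u s) i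
    have hy : ∀ t i, HasDerivAt (fun τ => y τ i) (((Φ t₀ t * B t) *ᵥ u t) i) t := by
      intro t i
      have hc : Continuous fun s => ((Φ t₀ s * B s) *ᵥ u s) i :=
        (continuous_apply i).comp (hQ.matrix_mulVec hu)
      exact (hc.integral_hasStrictDerivAt t₀ t).hasDerivAt.const_add _
    have hyf : y tf = Φ t₀ tf *ᵥ xf := by
      ext i
      have hGi := congrFun hGv i
      rw [hG, Matrix.of_integral_mulVec (hQ.matrix_mul hQ.matrix_transpose)] at hGi
      simp only [y, u, Matrix.mulVec_mulVec, hGi, Pi.sub_apply, add_sub_cancel]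
    refine ⟨u, hu, fun t => Φ t t₀ *ᵥ y t, fun t _ i => ?_, ?_, ?_⟩
    · refine (HasDerivAt.matrix_mulVec_apply (hΦderiv t₀ t) (hy t) i).congr_deriv ?_
      change _ = (A t *ᵥ (Φ t t₀ *ᵥ y t) + B t *ᵥ u t) i
      rw [Matrix.mulVec_mulVec (u t), Matrix.mulVec_mulVec (y t), ← Matrix.mul_assoc (Φ t t₀),
        hΦinv, Matrix.one_mul]
    · ext i
      simp [hΦ0, y]
    · simp only [hyf, Matrix.mulVec_mulVec, hΦinv, Matrix.one_mulVec]
end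

section
/- (Controllability Gramian criterion, discrete case.) Let A : ℤ → ℝ^{n×n} with I + A(t) invertible for every t, let B : ℤ → ℝ^{n×m}, and let Φ_A be the discrete transition matrix of the regressive system. Fix integers t₀ < t_f. Then the system x(t+1) = (I + A(t))x(t) + B(t)u(t) is controllable on [t₀, t_f] — i.e., for every x₀, x_f ∈ ℝⁿ there exist u : ℤ → ℝᵐ and x : ℤ → ℝⁿ with x(t+1) = (I + A(t))x(t) + B(t)u(t) for t₀ ≤ t < t_f, x(t₀) = x₀ and x(t_f) = x_f — if and only if the n×n controllability Gramian matrix G_C(t₀, t_f) = Σ_{s=t₀}^{t_f - 1} Φ_A(t₀, s+1) B(s) B(s)ᵀ Φ_A(t₀, s+1)ᵀ is invertible. -/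
open Matrix

/-- The Gramian `∑ s ∈ S, C s * (C s)ᵀ` of a finite family of real matrices is invertible exactly
when the images of the `C s` together span the whole space. -/
theorem isUnit_sum_mul_transpose_iff {ι n m : Type*} [Fintype n] [DecidableEq n] [Fintype m]
    (S : Finset ι) (C : ι → Matrix n m ℝ) :
    IsUnit (∑ s ∈ S, C s * (C s)ᵀ) ↔
      ∀ y : n → ℝ, ∃ u : ι → m → ℝ, ∑ s ∈ S, C s *ᵥ u s = y := by
  constructor
  · intro hG y
    obtain ⟨w, rfl⟩ := mulVec_surjective_iff_isUnit.mpr hG y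
    exact ⟨fun s => (C s)ᵀ *ᵥ w, by simp [sum_mulVec, mulVec_mulVec]⟩
  · intro hC
    rw [isUnit_iff_isUnit_det, isUnit_iff_ne_zero]
    intro hdet
    obtain ⟨v, hv, hGv⟩ := exists_mulVec_eq_zero_iff.mpr hdet
    have hquad : ∑ s ∈ S, (v ᵥ* C s) ⬝ᵥ (v ᵥ* C s) = 0 := by
      simpa [sum_mulVec, dotProduct_sum, ← mulVec_mulVec, dotProduct_mulVec, mulVec_transpose]
        using congrArg (v ⬝ᵥ ·) hGv
    have hzero : ∀ s ∈ S, v ᵥ* C s = 0 := fun s hs =>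
      dotProduct_self_eq_zero.mp <| (Finset.sum_eq_zero_iff_of_nonneg fun s _ =>
        Finset.sum_nonneg fun i _ => mul_self_nonneg _).mp hquad s hs
    obtain ⟨u, hu⟩ := hC v
    refine hv (dotProduct_self_eq_zero.mp ?_)
    nth_rewrite 2 [← hu]
    rw [dotProduct_sum]
    exact Finset.sum_eq_zero fun s hs => by rw [dotProduct_mulVec, hzero s hs, zero_dotProduct]

/-- Summation over an integer interval, extended by one point on the right. -/
theorem Int.sum_Ico_add_one_right {M : Type*} [AddCommMonoid M] {a b : ℤ} (hab : a ≤ b)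
    (f : ℤ → M) : ∑ s ∈ Finset.Ico a (b + 1), f s = ∑ s ∈ Finset.Ico a b, f s + f b := by
  have hIco : Finset.Ico a (b + 1) = insert b (Finset.Ico a b) := by
    ext s
    simp only [Finset.mem_Ico, Finset.mem_insert]
    omega
  rw [hIco, Finset.sum_insert (by simp), add_comm]

/-- Variation of constants, pulled back to the initial time: if `Q (t + 1) * F t = Q t`, then along
a trajectory of `x (t + 1) = F t *ᵥ x t + B t *ᵥ u t` the vector `Q t *ᵥ x t` changes by the sum of
the inputs transported by `Q`. -/
theorem mulVec_trajectory_eq_add_sum {R n m : Type*} [CommRing R] [Fintype n] [Fintype m]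
    {F Q : ℤ → Matrix n n R} {B : ℤ → Matrix n m R} (hQ : ∀ t, Q (t + 1) * F t = Q t)
    {t₀ tf : ℤ} {u : ℤ → m → R} {x : ℤ → n → R}
    (hx : ∀ t, t₀ ≤ t → t < tf → x (t + 1) = F t *ᵥ x t + B t *ᵥ u t)
    {t : ℤ} (ht₀ : t₀ ≤ t) (htf : t ≤ tf) :
    Q t *ᵥ x t = Q t₀ *ᵥ x t₀ + ∑ s ∈ Finset.Ico t₀ t, (Q (s + 1) * B s) *ᵥ u s := by
  induction t, ht₀ using Int.leInduction with
  | base => simp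
  | succ t ht ih =>
    rw [hx t ht (by omega), mulVec_add, mulVec_mulVec, hQ, ih (by omega), mulVec_mulVec,
      Int.sum_Ico_add_one_right ht, add_assoc]

/-- Controllability Gramian criterion (discrete case): the regressive system
x(t+1) = (I + A(t))x(t) + B(t)u(t) is controllable on [t₀, t_f] iff the controllability
Gramian G_C(t₀,t_f) = Σ_{s=t₀}^{t_f-1} Φ_A(t₀,s+1) B(s) B(s)ᵀ Φ_A(t₀,s+1)ᵀ is invertible. -/
theorem controllability_gramian_criterion_discrete {n m : ℕ}
    (A : ℤ → Matrix (Fin n) (Fin n) ℝ) (B : ℤ → Matrix (Fin n) (Fin m) ℝ)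
    (hreg : ∀ t : ℤ, IsUnit (1 + A t))
    (Φ : ℤ → ℤ → Matrix (Fin n) (Fin n) ℝ)
    (hΦ0 : ∀ s : ℤ, Φ s s = 1)
    (hΦrec : ∀ t s : ℤ, Φ (t+1) s = (1 + A t) * Φ t s)
    (hΦinv : ∀ t s : ℤ, Φ t s * Φ s t = 1)
    (t₀ tf : ℤ) (h : t₀ < tf) :
    (∀ x₀ xf : Fin n → ℝ, ∃ u : ℤ → Fin m → ℝ, ∃ x : ℤ → Fin n → ℝ,
        (∀ t : ℤ, t₀ ≤ t → t < tf →
          x (t+1) = (1 + A t).mulVec (x t) + (B t).mulVec (u t)) ∧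
        x t₀ = x₀ ∧ x tf = xf) ↔
    IsUnit (∑ s ∈ Finset.Ico t₀ tf, Φ t₀ (s+1) * B s * (B s)ᵀ * (Φ t₀ (s+1))ᵀ) := by
  have hQ : ∀ t, Φ t₀ (t + 1) * (1 + A t) = Φ t₀ t := fun t => by
    calc Φ t₀ (t + 1) * (1 + A t)
        = Φ t₀ (t + 1) * ((1 + A t) * Φ t t₀) * Φ t₀ t := by
          rw [Matrix.mul_assoc, Matrix.mul_assoc, hΦinv, Matrix.mul_one]
      _ = Φ t₀ t := by rw [← hΦrec, hΦinv, Matrix.one_mul]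
  have hG : ∑ s ∈ Finset.Ico t₀ tf, Φ t₀ (s+1) * B s * (B s)ᵀ * (Φ t₀ (s+1))ᵀ =
      ∑ s ∈ Finset.Ico t₀ tf, (Φ t₀ (s + 1) * B s) * (Φ t₀ (s + 1) * B s)ᵀ := by
    simp only [transpose_mul, Matrix.mul_assoc]
  rw [hG, isUnit_sum_mul_transpose_iff]
  constructor
  · intro hctrl y
    obtain ⟨u, x, hx, hx₀, hxf⟩ := hctrl 0 (Φ tf t₀ *ᵥ y)
    refine ⟨u, ?_⟩
    simpa [hx₀, hxf, mulVec_mulVec, hΦinv] using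
      (mulVec_trajectory_eq_add_sum hQ hx h.le le_rfl).symm
  · intro hspan x₀ xf
    obtain ⟨u, hu⟩ := hspan (Φ t₀ tf *ᵥ xf - x₀)
    refine ⟨u, fun t => Φ t t₀ *ᵥ
      (x₀ + ∑ s ∈ Finset.Ico t₀ t, (Φ t₀ (s + 1) * B s) *ᵥ u s), fun t ht _ => ?_, ?_, ?_⟩
    · beta_reduce
      rw [Int.sum_Ico_add_one_right ht, ← add_assoc, mulVec_add, mulVec_mulVec,
        ← Matrix.mul_assoc, hΦinv, Matrix.one_mul, hΦrec, mulVec_mulVec]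
    · simp [hΦ0]
    · simp [hu, mulVec_mulVec, hΦinv]
end

section
/- (Stability under state variable change, discrete case.) Let A : ℤ → ℝ^{n×n}, let α > 0, 0 < λ < 1 and γ > 0. Suppose every z : ℤ → ℝⁿ satisfying the difference equation z(t+1) - z(t) = [(1+α)A(t) + αI]z(t) for all t obeys ‖z(t)‖ ≤ γ (1-λ)^{t - t₀} ‖z(t₀)‖ for all integers t ≥ t₀. Then every x : ℤ → ℝⁿ satisfying x(t+1) - x(t) = A(t)x(t) for all t obeys ‖x(t)‖ ≤ γ ((1-λ)/(1+α))^{t - t₀} ‖x(t₀)‖ for all integers t ≥ t₀; i.e., the x-system is uniformly exponentially stable with rate (λ + α)/(1 + α). -/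
/-- The Euclidean norm on ℝⁿ. -/
noncomputable def euclNorm {n : ℕ} (x : Fin n → ℝ) : ℝ := Real.sqrt (∑ i, x i ^ 2)

theorem euclNorm_smul {n : ℕ} {c : ℝ} (hc : 0 ≤ c) (x : Fin n → ℝ) :
    euclNorm (c • x) = c * euclNorm x := by
  simp only [euclNorm, Pi.smul_apply, smul_eq_mul, mul_pow, ← Finset.mul_sum]
  rw [Real.sqrt_mul (sq_nonneg c), Real.sqrt_sq hc]

/-- Stability under state variable change (discrete case): if every solution of
z(t+1) - z(t) = [(1+α)A(t) + αI]z(t) decays like γ(1-λ)^{t-t₀}, then every solution of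
x(t+1) - x(t) = A(t)x(t) decays like γ((1-λ)/(1+α))^{t-t₀}; i.e. the x-system is
uniformly exponentially stable with rate (λ+α)/(1+α). -/
theorem stability_under_state_variable_change_discrete {n : ℕ}
    (A : ℤ → Matrix (Fin n) (Fin n) ℝ)
    (α lam γ : ℝ) (hα : 0 < α) (hlam0 : 0 < lam) (hlam1 : lam < 1) (hγ : 0 < γ)
    (hz : ∀ z : ℤ → Fin n → ℝ,
      (∀ t : ℤ, z (t+1) - z t =
        ((1 + α) • A t + α • (1 : Matrix (Fin n) (Fin n) ℝ)).mulVec (z t)) →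
      ∀ t₀ t : ℤ, t₀ ≤ t →
        euclNorm (z t) ≤ γ * (1 - lam) ^ (t - t₀) * euclNorm (z t₀)) :
    ∀ x : ℤ → Fin n → ℝ,
      (∀ t : ℤ, x (t+1) - x t = (A t).mulVec (x t)) →
      ∀ t₀ t : ℤ, t₀ ≤ t →
        euclNorm (x t) ≤ γ * ((1 - lam) / (1 + α)) ^ (t - t₀) * euclNorm (x t₀) := by
  intro x hx t₀ t ht
  have hpos : 0 < 1 + α := by linarith
  have hstep : ∀ s : ℤ, (1 + α) ^ (s + 1) • x (s + 1) - (1 + α) ^ s • x s =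
      ((1 + α) • A s + α • (1 : Matrix (Fin n) (Fin n) ℝ)).mulVec ((1 + α) ^ s • x s) := by
    intro s
    rw [Matrix.mulVec_smul, Matrix.add_mulVec, Matrix.smul_mulVec, Matrix.smul_mulVec,
      Matrix.one_mulVec, ← hx s, zpow_add_one₀ hpos.ne']
    module
  have h := hz (fun s => (1 + α) ^ s • x s) hstep t₀ t ht
  simp only [euclNorm_smul (zpow_pos hpos _).le] at h
  refine le_of_mul_le_mul_left (h.trans_eq ?_) (zpow_pos hpos t)
  rw [div_zpow, zpow_sub₀ hpos.ne']
  have h₀ := (zpow_pos hpos t₀).ne'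
  have h₁ := (zpow_pos hpos t).ne'
  generalize (1 - lam) ^ (t - t₀) = q
  generalize (1 + α) ^ t₀ = a at *
  generalize (1 + α) ^ t = b at *
  field_simp
end

section
/- (Lyapunov exponential stability criterion, continuous case.) Let A : ℝ → ℝ^{n×n} be continuous. Suppose there exist a continuously differentiable map Q : ℝ → ℝ^{n×n} with Q(t) symmetric for all t, and constants η, ρ, ν > 0, such that for all t ∈ ℝ: (i) η I ≤ Q(t) ≤ ρ I in the Loewner order, and (ii) Q'(t) + A(t)ᵀ Q(t) + Q(t) A(t) ≤ -ν I in the Loewner order. Then the system x'(t) = A(t)x(t) is uniformly exponentially stable: there exist λ > 0 and γ > 0 such that every differentiable x : ℝ → ℝⁿ with x'(t) = A(t)x(t) for all t satisfies ‖x(t)‖ ≤ γ e^{-λ(t-t₀)} ‖x(t₀)‖ for all t ≥ t₀ and all t₀ ∈ ℝ. -/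
open Matrix

theorem HasDerivAt.dotProduct_pi {n : Type*} [Fintype n] {u v : ℝ → n → ℝ} {u' v' : n → ℝ} {t : ℝ}
    (hu : ∀ i, HasDerivAt (fun τ => u τ i) (u' i) t)
    (hv : ∀ i, HasDerivAt (fun τ => v τ i) (v' i) t) :
    HasDerivAt (fun τ => u τ ⬝ᵥ v τ) (u' ⬝ᵥ v t + u t ⬝ᵥ v') t := by
  simp only [dotProduct, ← Finset.sum_add_distrib]
  exact HasDerivAt.fun_sum fun i _ => (hu i).mul (hv i)

theorem hasDerivAt_dotProduct_mulVec {n : Type*} [Fintype n] {A Q' : Matrix n n ℝ}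
    {Q : ℝ → Matrix n n ℝ} {x : ℝ → n → ℝ} {t : ℝ}
    (hQ : ∀ i j, HasDerivAt (fun τ => Q τ i j) (Q' i j) t)
    (hx : ∀ i, HasDerivAt (fun τ => x τ i) ((A *ᵥ x t) i) t) :
    HasDerivAt (fun τ => x τ ⬝ᵥ Q τ *ᵥ x τ)
      (x t ⬝ᵥ (Q' + Aᵀ * Q t + Q t * A) *ᵥ x t) t := by
  have hQx (i : n) : HasDerivAt (fun τ => (Q τ *ᵥ x τ) i)
      ((Q' *ᵥ x t + Q t *ᵥ (A *ᵥ x t)) i) t :=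
    HasDerivAt.dotProduct_pi (hQ i) hx
  convert HasDerivAt.dotProduct_pi hx hQx using 1
  have h : x t ⬝ᵥ Aᵀ *ᵥ (Q t *ᵥ x t) = (A *ᵥ x t) ⬝ᵥ Q t *ᵥ x t := by
    rw [dotProduct_mulVec, vecMul_transpose]
  simp only [add_mulVec, dotProduct_add, ← mulVec_mulVec, h]
  ring

theorem Matrix.PosSemidef.dotProduct_mulVec_le {n : Type*} [Fintype n] {P R : Matrix n n ℝ}
    (h : (R - P).PosSemidef) (x : n → ℝ) : x ⬝ᵥ P *ᵥ x ≤ x ⬝ᵥ R *ᵥ x := by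
  have := h.dotProduct_mulVec_nonneg x
  simpa [sub_mulVec, dotProduct_sub] using this

theorem dotProduct_smul_one_mulVec {n : Type*} [Fintype n] [DecidableEq n] (c : ℝ) (x : n → ℝ) :
    x ⬝ᵥ (c • (1 : Matrix n n ℝ)) *ᵥ x = c * (x ⬝ᵥ x) := by
  simp [smul_mulVec]

theorem le_exp_mul_of_hasDerivAt_le {V V' : ℝ → ℝ} {c : ℝ} (hV : ∀ t, HasDerivAt V (V' t) t)
    (hle : ∀ t, V' t ≤ -c * V t) {t₀ t : ℝ} (ht : t₀ ≤ t) :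
    V t ≤ Real.exp (-c * (t - t₀)) * V t₀ := by
  have hW (s : ℝ) : HasDerivAt (fun s => V s * Real.exp (c * s))
      (V' s * Real.exp (c * s) + V s * (Real.exp (c * s) * (c * 1))) s :=
    (hV s).mul ((hasDerivAt_id s).const_mul c).exp
  have hanti : Antitone fun s => V s * Real.exp (c * s) := by
    refine antitone_of_deriv_nonpos (fun s => (hW s).differentiableAt) fun s => ?_
    rw [(hW s).deriv]
    nlinarith [mul_le_mul_of_nonneg_right (hle s) (Real.exp_pos (c * s)).le]
  have h := hanti ht
  have hexp : Real.exp (-c * (t - t₀)) = Real.exp (c * t₀) / Real.exp (c * t) := by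
    rw [← Real.exp_sub]
    ring_nf
  rw [hexp, div_mul_eq_mul_div, le_div_iff₀ (Real.exp_pos _)]
  linarith [h]

theorem euclNorm_eq_sqrt_dotProduct {n : ℕ} (x : Fin n → ℝ) : euclNorm x = √(x ⬝ᵥ x) := by
  simp [euclNorm, dotProduct, sq]

/-- Lyapunov exponential stability criterion (continuous case): if there is a continuously
differentiable symmetric Q(t) with ηI ≤ Q(t) ≤ ρI and Q'(t) + A(t)ᵀQ(t) + Q(t)A(t) ≤ -νI
in the Loewner order, then x' = A(t)x is uniformly exponentially stable. -/
theorem lyapunov_exponential_stability_continuous {n : ℕ}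
    (A : ℝ → Matrix (Fin n) (Fin n) ℝ)
    (hA : ∀ i j, Continuous fun t => A t i j)
    (Q Q' : ℝ → Matrix (Fin n) (Fin n) ℝ)
    (hQderiv : ∀ t : ℝ, ∀ i j, HasDerivAt (fun τ => Q τ i j) (Q' t i j) t)
    (hQ'cont : ∀ i j, Continuous fun t => Q' t i j)
    (hQsymm : ∀ t : ℝ, (Q t).IsSymm)
    (η ρ ν : ℝ) (hη : 0 < η) (hρ : 0 < ρ) (hν : 0 < ν)
    (hlow : ∀ t : ℝ, (Q t - η • (1 : Matrix (Fin n) (Fin n) ℝ)).PosSemidef)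
    (hup : ∀ t : ℝ, (ρ • (1 : Matrix (Fin n) (Fin n) ℝ) - Q t).PosSemidef)
    (hlyap : ∀ t : ℝ,
      (-(ν • (1 : Matrix (Fin n) (Fin n) ℝ)) - (Q' t + (A t)ᵀ * Q t + Q t * A t)).PosSemidef) :
    ∃ lam : ℝ, 0 < lam ∧ ∃ γ : ℝ, 0 < γ ∧
      ∀ x : ℝ → Fin n → ℝ,
        (∀ t : ℝ, ∀ i, HasDerivAt (fun τ => x τ i) ((A t).mulVec (x t) i) t) →
        ∀ t₀ t : ℝ, t₀ ≤ t →
          euclNorm (x t) ≤ γ * Real.exp (-lam * (t - t₀)) * euclNorm (x t₀) := by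
  refine ⟨ν / ρ / 2, by positivity, √(ρ / η), by positivity, fun x hx t₀ t ht => ?_⟩
  have hVlow (s : ℝ) : η * (x s ⬝ᵥ x s) ≤ x s ⬝ᵥ Q s *ᵥ x s := by
    simpa only [dotProduct_smul_one_mulVec] using (hlow s).dotProduct_mulVec_le (x s)
  have hVup (s : ℝ) : x s ⬝ᵥ Q s *ᵥ x s ≤ ρ * (x s ⬝ᵥ x s) := by
    simpa only [dotProduct_smul_one_mulVec] using (hup s).dotProduct_mulVec_le (x s)
  have hdecay (s : ℝ) : x s ⬝ᵥ (Q' s + (A s)ᵀ * Q s + Q s * A s) *ᵥ x s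
      ≤ -(ν / ρ) * (x s ⬝ᵥ Q s *ᵥ x s) := by
    have h := (hlyap s).dotProduct_mulVec_le (x s)
    rw [neg_mulVec, dotProduct_neg, dotProduct_smul_one_mulVec] at h
    have h' : ν / ρ * (x s ⬝ᵥ Q s *ᵥ x s) ≤ ν / ρ * (ρ * (x s ⬝ᵥ x s)) :=
      mul_le_mul_of_nonneg_left (hVup s) (by positivity)
    rw [← mul_assoc, div_mul_cancel₀ ν hρ.ne'] at h'
    linarith
  have hV := le_exp_mul_of_hasDerivAt_le
    (fun s => hasDerivAt_dotProduct_mulVec (hQderiv s) (hx s)) hdecay ht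
  have hsq : x t ⬝ᵥ x t ≤ ρ / η * Real.exp (-(ν / ρ) * (t - t₀)) * (x t₀ ⬝ᵥ x t₀) := by
    have h := mul_le_mul_of_nonneg_left (hVup t₀) (Real.exp_pos (-(ν / ρ) * (t - t₀))).le
    rw [div_mul_eq_mul_div, div_mul_eq_mul_div, le_div_iff₀ hη]
    linarith [hVlow t]
  have hexp : Real.exp (-(ν / ρ / 2) * (t - t₀)) = √(Real.exp (-(ν / ρ) * (t - t₀))) := by
    rw [← Real.exp_half]
    ring_nf
  rw [euclNorm_eq_sqrt_dotProduct, euclNorm_eq_sqrt_dotProduct, hexp,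
    ← Real.sqrt_mul (by positivity), ← Real.sqrt_mul (by positivity)]
  exact Real.sqrt_le_sqrt hsq
end

section
/- (Lyapunov exponential stability criterion, discrete case.) Let A : ℤ → ℝ^{n×n}. Suppose there exist a map Q : ℤ → ℝ^{n×n} with Q(t) symmetric for all t, and constants η, ρ, ν > 0 with ν < ρ, such that for all t ∈ ℤ: (i) η I ≤ Q(t) ≤ ρ I in the Loewner order, and (ii) (I + A(t))ᵀ Q(t+1) (I + A(t)) - Q(t) ≤ -ν I in the Loewner order. Then the system x(t+1) = (I + A(t))x(t) is uniformly exponentially stable: there exist λ ∈ (0,1) and γ > 0 such that every x : ℤ → ℝⁿ satisfying the recurrence obeys ‖x(t)‖ ≤ γ (1-λ)^{t-t₀} ‖x(t₀)‖ for all integers t ≥ t₀. -/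
open Matrix

/-- The quadratic form `xᵀ M x`. -/
def quadForm {n : ℕ} (M : Matrix (Fin n) (Fin n) ℝ) (x : Fin n → ℝ) : ℝ := x ⬝ᵥ (M *ᵥ x)

theorem euclNorm_nonneg {n : ℕ} (x : Fin n → ℝ) : 0 ≤ euclNorm x := Real.sqrt_nonneg _

theorem euclNorm_sq {n : ℕ} (x : Fin n → ℝ) : euclNorm x ^ 2 = x ⬝ᵥ x := by
  rw [euclNorm, Real.sq_sqrt (Finset.sum_nonneg fun i _ => sq_nonneg (x i))]
  simp only [dotProduct, pow_two]

theorem mul_euclNorm_sq_le_quadForm {n : ℕ} {M : Matrix (Fin n) (Fin n) ℝ} {η : ℝ}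
    (h : (M - η • (1 : Matrix (Fin n) (Fin n) ℝ)).PosSemidef) (x : Fin n → ℝ) :
    η * euclNorm x ^ 2 ≤ quadForm M x := by
  have := h.dotProduct_mulVec_nonneg x
  simp only [star_trivial, sub_mulVec, smul_mulVec, one_mulVec, dotProduct_sub,
    dotProduct_smul, smul_eq_mul] at this
  rw [euclNorm_sq, quadForm]
  linarith

theorem quadForm_le_mul_euclNorm_sq {n : ℕ} {M : Matrix (Fin n) (Fin n) ℝ} {ρ : ℝ}
    (h : (ρ • (1 : Matrix (Fin n) (Fin n) ℝ) - M).PosSemidef) (x : Fin n → ℝ) :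
    quadForm M x ≤ ρ * euclNorm x ^ 2 := by
  have := h.dotProduct_mulVec_nonneg x
  simp only [star_trivial, sub_mulVec, smul_mulVec, one_mulVec, dotProduct_sub,
    dotProduct_smul, smul_eq_mul] at this
  rw [euclNorm_sq, quadForm]
  linarith

theorem quadForm_mulVec {n : ℕ} (M B : Matrix (Fin n) (Fin n) ℝ) (x : Fin n → ℝ) :
    quadForm M (B *ᵥ x) = x ⬝ᵥ ((Bᵀ * M * B) *ᵥ x) := by
  rw [quadForm, Matrix.mul_assoc, ← mulVec_mulVec, ← mulVec_mulVec, dotProduct_mulVec x,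
    vecMul_transpose]

/-- One step of the recurrence decreases the Lyapunov function by at least `ν ‖x‖²`. -/
theorem quadForm_mulVec_le {n : ℕ} {B P M : Matrix (Fin n) (Fin n) ℝ} {ν : ℝ}
    (h : (-(ν • (1 : Matrix (Fin n) (Fin n) ℝ)) - (Bᵀ * P * B - M)).PosSemidef)
    (x : Fin n → ℝ) :
    quadForm P (B *ᵥ x) ≤ quadForm M x - ν * euclNorm x ^ 2 := by
  have := h.dotProduct_mulVec_nonneg x
  simp only [star_trivial, sub_mulVec, neg_mulVec, smul_mulVec, one_mulVec, dotProduct_sub,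
    dotProduct_neg, dotProduct_smul, smul_eq_mul] at this
  rw [euclNorm_sq, quadForm_mulVec, quadForm]
  linarith

/-- Lyapunov exponential stability criterion (discrete case): if there is a symmetric Q(t)
with ηI ≤ Q(t) ≤ ρI and (I+A(t))ᵀQ(t+1)(I+A(t)) - Q(t) ≤ -νI in the Loewner order (with
0 < ν < ρ), then x(t+1) = (I + A(t))x(t) is uniformly exponentially stable. -/
theorem lyapunov_exponential_stability_discrete {n : ℕ}
    (A : ℤ → Matrix (Fin n) (Fin n) ℝ)
    (Q : ℤ → Matrix (Fin n) (Fin n) ℝ)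
    (hQsymm : ∀ t : ℤ, (Q t).IsSymm)
    (η ρ ν : ℝ) (hη : 0 < η) (hρ : 0 < ρ) (hν : 0 < ν) (hνρ : ν < ρ)
    (hlow : ∀ t : ℤ, (Q t - η • (1 : Matrix (Fin n) (Fin n) ℝ)).PosSemidef)
    (hup : ∀ t : ℤ, (ρ • (1 : Matrix (Fin n) (Fin n) ℝ) - Q t).PosSemidef)
    (hlyap : ∀ t : ℤ,
      (-(ν • (1 : Matrix (Fin n) (Fin n) ℝ)) -
        ((1 + A t)ᵀ * Q (t+1) * (1 + A t) - Q t)).PosSemidef) :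
    ∃ lam : ℝ, 0 < lam ∧ lam < 1 ∧ ∃ γ : ℝ, 0 < γ ∧
      ∀ x : ℤ → Fin n → ℝ,
        (∀ t : ℤ, x (t+1) = (1 + A t).mulVec (x t)) →
        ∀ t₀ t : ℤ, t₀ ≤ t →
          euclNorm (x t) ≤ γ * (1 - lam) ^ (t - t₀) * euclNorm (x t₀) := by
  have hq : 0 < 1 - ν / ρ := sub_pos.2 ((div_lt_one hρ).2 hνρ)
  have hq1 : 1 - ν / ρ < 1 := sub_lt_self _ (div_pos hν hρ)
  set r := Real.sqrt (1 - ν / ρ) with hr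
  have hr0 : 0 < r := Real.sqrt_pos.2 hq
  have hr1 : r < 1 := (Real.sqrt_lt' one_pos).2 (by simpa using hq1)
  have hr2 : r ^ 2 = 1 - ν / ρ := Real.sq_sqrt hq.le
  refine ⟨1 - r, by linarith, by linarith, Real.sqrt (ρ / η),
    Real.sqrt_pos.2 (div_pos hρ hη), fun x hx t₀ t ht => ?_⟩
  obtain ⟨k, rfl⟩ := Int.le.dest ht
  have hstep (s : ℤ) : quadForm (Q (s + 1)) (x (s + 1)) ≤ r ^ 2 * quadForm (Q s) (x s) := by
    have hdec := quadForm_mulVec_le (hlyap s) (x s)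
    have hle : ν / ρ * quadForm (Q s) (x s) ≤ ν * euclNorm (x s) ^ 2 :=
      (mul_le_mul_of_nonneg_left (quadForm_le_mul_euclNorm_sq (hup s) (x s))
        (div_pos hν hρ).le).trans_eq (by field_simp)
    rw [hx s, hr2]
    linarith
  have hdecay (k : ℕ) :
      quadForm (Q (t₀ + k)) (x (t₀ + k)) ≤ (r ^ 2) ^ k * quadForm (Q t₀) (x t₀) := by
    induction k with
    | zero => simp
    | succ k ih =>
      rw [Nat.cast_succ, ← add_assoc, pow_succ', mul_assoc]
      exact (hstep _).trans (mul_le_mul_of_nonneg_left ih (sq_nonneg r))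
  rw [sub_sub_cancel, add_sub_cancel_left, zpow_natCast]
  refine (sq_le_sq₀ (euclNorm_nonneg _) (mul_nonneg (by positivity) (euclNorm_nonneg _))).1 ?_
  rw [mul_pow, mul_pow, Real.sq_sqrt (div_pos hρ hη).le, pow_right_comm, div_mul_eq_mul_div,
    div_mul_eq_mul_div, le_div_iff₀ hη]
  calc euclNorm (x (t₀ + k)) ^ 2 * η
      ≤ quadForm (Q (t₀ + k)) (x (t₀ + k)) := by
        rw [mul_comm]; exact mul_euclNorm_sq_le_quadForm (hlow _) _
    _ ≤ (r ^ 2) ^ k * (ρ * euclNorm (x t₀) ^ 2) :=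
        (hdecay k).trans (mul_le_mul_of_nonneg_left
          (quadForm_le_mul_euclNorm_sq (hup t₀) _) (by positivity))
    _ = ρ * (r ^ 2) ^ k * euclNorm (x t₀) ^ 2 := by ring
end

section
/- (Weighted Gramian differential identity, continuous case.) Let A : ℝ → ℝ^{n×n} and B : ℝ → ℝ^{n×m} be continuous, let Φ_A be the state transition matrix of A, and let α > 0. Then for each fixed T, the map t ↦ G_α(t, T) is differentiable on (-∞, T] with (entrywise) derivative ∂/∂t G_α(t,T) = -B(t)B(t)ᵀ + 4α G_α(t,T) + A(t) G_α(t,T) + G_α(t,T) A(t)ᵀ. -/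
open Matrix MeasureTheory

/-- The α-weighted controllability Gramian on ℝ:
`G_α(t,T) = ∫_t^T e^{-4α(s-t)} Φ(t,s) B(s) B(s)ᵀ Φ(t,s)ᵀ ds` (entrywise integral). -/
noncomputable def cGram {n m : ℕ} (Φ : ℝ → ℝ → Matrix (Fin n) (Fin n) ℝ)
    (B : ℝ → Matrix (Fin n) (Fin m) ℝ) (α : ℝ) (t T : ℝ) : Matrix (Fin n) (Fin n) ℝ :=
  Matrix.of fun i j =>
    ∫ s in t..T, Real.exp (-(4 * α) * (s - t)) * ((Φ t s * B s * (B s)ᵀ * (Φ t s)ᵀ) i j)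

/-- Leibniz rule for matrix products, entrywise. -/
theorem hasDerivAt_matrix_mul_apply {l m n : Type*} [Fintype m]
    {M : ℝ → Matrix l m ℝ} {N : ℝ → Matrix m n ℝ} {M' : Matrix l m ℝ} {N' : Matrix m n ℝ} {t : ℝ}
    (hM : ∀ i j, HasDerivAt (fun τ => M τ i j) (M' i j) t)
    (hN : ∀ i j, HasDerivAt (fun τ => N τ i j) (N' i j) t) (i : l) (j : n) :
    HasDerivAt (fun τ => (M τ * N τ) i j) ((M' * N t + M t * N') i j) t := by
  simp only [Matrix.add_apply, Matrix.mul_apply, ← Finset.sum_add_distrib]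
  exact HasDerivAt.fun_sum fun k _ => (hM i k).mul (hN k j)

/-- Multiplication by constant matrices commutes with entrywise integration. -/
theorem intervalIntegral_matrix_mul_mul_apply {k l m n : Type*} [Fintype l] [Fintype m]
    (M : Matrix k l ℝ) (N : Matrix m n ℝ) {K : ℝ → Matrix l m ℝ} (hK : Continuous K)
    (a b : ℝ) (i : k) (j : n) :
    ∫ s in a..b, (M * K s * N) i j =
      (M * (Matrix.of fun p q => ∫ s in a..b, K s p q) * N) i j := by
  have hK' : ∀ p q, IntervalIntegrable (fun s => K s p q) volume a b := fun p q =>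
    (hK.matrix_elem p q).intervalIntegrable a b
  simp only [Matrix.mul_apply, Finset.sum_mul, Matrix.of_apply]
  rw [intervalIntegral.integral_finsetSum fun q _ => (continuous_finsetSum _ fun p _ =>
    ((hK.matrix_elem p q).const_mul (M i p)).mul_const (N q j)).intervalIntegrable a b]
  refine Finset.sum_congr rfl fun q _ => ?_
  rw [intervalIntegral.integral_finsetSum fun p _ =>
    ((hK' p q).const_mul (M i p)).mul_const (N q j)]
  refine Finset.sum_congr rfl fun p _ => ?_
  rw [intervalIntegral.integral_mul_const, intervalIntegral.integral_const_mul]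

/-- A pointwise right inverse of a continuous matrix-valued map is continuous. -/
theorem continuous_of_matrix_mul_eq_one {X n : Type*} [TopologicalSpace X] [Fintype n]
    [DecidableEq n] {M N : X → Matrix n n ℝ} (hM : Continuous M) (hMN : ∀ x, M x * N x = 1) :
    Continuous N := by
  have hdet : ∀ x, (M x).det ≠ 0 := fun x => (Matrix.isUnit_det_of_right_inverse (hMN x)).ne_zero
  have hN : N = fun x => (M x).det⁻¹ • (M x).adjugate := by
    funext x
    rw [← Matrix.inv_eq_right_inv (hMN x), Matrix.inv_def, Ring.inverse_eq_inv']
  rw [hN]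
  exact (hM.matrix_det.inv₀ hdet).smul hM.matrix_adjugate

/-- Weighted Gramian differential identity (continuous case): for fixed T, the map
t ↦ G_α(t,T) is differentiable on (-∞,T] with entrywise derivative
`∂/∂t G_α(t,T) = -B(t)B(t)ᵀ + 4α G_α(t,T) + A(t) G_α(t,T) + G_α(t,T) A(t)ᵀ`. -/
theorem weighted_gramian_differential_identity_continuous {n m : ℕ}
    (A : ℝ → Matrix (Fin n) (Fin n) ℝ) (B : ℝ → Matrix (Fin n) (Fin m) ℝ)
    (hA : ∀ i j, Continuous fun t => A t i j)
    (hB : ∀ i j, Continuous fun t => B t i j)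
    (Φ : ℝ → ℝ → Matrix (Fin n) (Fin n) ℝ)
    (hΦ0 : ∀ s : ℝ, Φ s s = 1)
    (hΦderiv : ∀ s t : ℝ, ∀ i j, HasDerivAt (fun τ => Φ τ s i j) ((A t * Φ t s) i j) t)
    (hΦmul : ∀ t s r : ℝ, Φ t s * Φ s r = Φ t r)
    (hΦinv : ∀ t s : ℝ, Φ t s * Φ s t = 1)
    (α : ℝ) (hα : 0 < α) (T : ℝ) :
    ∀ t : ℝ, t ≤ T → ∀ i j,
      HasDerivWithinAt (fun τ => cGram Φ B α τ T i j)
        ((-(B t * (B t)ᵀ) + (4 * α) • cGram Φ B α t T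
          + A t * cGram Φ B α t T + cGram Φ B α t T * (A t)ᵀ) i j)
        (Set.Iic T) t := by
  intro t _ i j
  refine HasDerivAt.hasDerivWithinAt ?_
  have hPcont : Continuous fun τ => Φ τ 0 := continuous_matrix fun p q =>
    continuous_iff_continuousAt.2 fun τ => (hΦderiv 0 τ p q).continuousAt
  have hQcont : Continuous fun s => Φ 0 s :=
    continuous_of_matrix_mul_eq_one hPcont fun s => hΦinv s 0
  have hBcont : Continuous B := continuous_matrix hB
  set K : ℝ → Matrix (Fin n) (Fin n) ℝ := fun s =>
    Real.exp (-(4 * α) * s) • (Φ 0 s * B s * (B s)ᵀ * (Φ 0 s)ᵀ) with hK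
  have hKcont : Continuous K := by
    have hexp : Continuous fun s : ℝ => Real.exp (-(4 * α) * s) := by fun_prop
    exact hexp.smul (((hQcont.matrix_mul hBcont).matrix_mul hBcont.matrix_transpose).matrix_mul
      hQcont.matrix_transpose)
  set H : ℝ → Matrix (Fin n) (Fin n) ℝ := fun τ =>
    Matrix.of fun p q => ∫ s in τ..T, K s p q with hH
  have hHderiv : ∀ p q, HasDerivAt (fun τ => H τ p q) ((-K t) p q) t := fun p q =>
    intervalIntegral.integral_hasDerivAt_left ((hKcont.matrix_elem p q).intervalIntegrable t T)
      (hKcont.matrix_elem p q).stronglyMeasurable.stronglyMeasurableAtFilter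
      (hKcont.matrix_elem p q).continuousAt
  have hconj : ∀ τ s, Real.exp (-(4 * α) * (s - τ)) • (Φ τ s * B s * (B s)ᵀ * (Φ τ s)ᵀ) =
      Real.exp (4 * α * τ) • (Φ τ 0 * K s * (Φ τ 0)ᵀ) := by
    intro τ s
    rw [← hΦmul τ 0 s, hK, show -(4 * α) * (s - τ) = 4 * α * τ + -(4 * α) * s by ring,
      Real.exp_add]
    simp only [Matrix.transpose_mul, Matrix.mul_smul, Matrix.smul_mul, smul_smul,
      Matrix.mul_assoc]
  have hG : ∀ τ, cGram Φ B α τ T = Real.exp (4 * α * τ) • (Φ τ 0 * H τ * (Φ τ 0)ᵀ) := by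
    intro τ
    ext p q
    have hint : ∀ s, Real.exp (-(4 * α) * (s - τ)) * (Φ τ s * B s * (B s)ᵀ * (Φ τ s)ᵀ) p q =
        Real.exp (4 * α * τ) * (Φ τ 0 * K s * (Φ τ 0)ᵀ) p q := fun s =>
      congrFun (congrFun (hconj τ s) p) q
    simp only [cGram, Matrix.of_apply, hint, intervalIntegral.integral_const_mul,
      intervalIntegral_matrix_mul_mul_apply _ _ hKcont, Matrix.smul_apply, smul_eq_mul, hH]
  have hBB : B t * (B t)ᵀ = Real.exp (4 * α * t) • (Φ t 0 * K t * (Φ t 0)ᵀ) := by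
    simpa [hΦ0] using hconj t t
  have hexp : HasDerivAt (fun τ => Real.exp (4 * α * τ)) (Real.exp (4 * α * t) * (4 * α)) t := by
    simpa using ((hasDerivAt_id t).const_mul (4 * α)).exp
  have hprod := hasDerivAt_matrix_mul_apply
    (hasDerivAt_matrix_mul_apply (hΦderiv 0 t) hHderiv)
    (N := fun τ => (Φ τ 0)ᵀ) (N' := (A t * Φ t 0)ᵀ) (fun p q => hΦderiv 0 t q p) i j
  have hmain := hexp.mul hprod
  have hval : -(B t * (B t)ᵀ) + (4 * α) • cGram Φ B α t T + A t * cGram Φ B α t T +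
        cGram Φ B α t T * (A t)ᵀ =
      (Real.exp (4 * α * t) * (4 * α)) • (Φ t 0 * H t * (Φ t 0)ᵀ) +
        Real.exp (4 * α * t) • ((A t * Φ t 0 * H t + Φ t 0 * -K t) * (Φ t 0)ᵀ +
          Φ t 0 * H t * (A t * Φ t 0)ᵀ) := by
    rw [hBB, hG]
    simp only [Matrix.transpose_mul, Matrix.mul_smul, Matrix.smul_mul, smul_smul, Matrix.add_mul,
      Matrix.mul_neg, Matrix.neg_mul, Matrix.mul_assoc, smul_add, smul_neg,
      mul_comm (4 * α) (Real.exp _)]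
    abel
  rw [hval]
  simp only [hG]
  exact hmain
end

section
/- (Weighted versus unweighted Gramian comparison, discrete case.) Let A : ℤ → ℝ^{n×n} with I + A(t) invertible for every t, let B : ℤ → ℝ^{n×m}, let Φ_A be the discrete transition matrix, let α > 0 and let k ≥ 1 be an integer. Then for every t ∈ ℤ, in the Loewner order, (1+α)^{-4k} G_0(t, t+k) ≤ G_α(t, t+k) ≤ G_0(t, t+k). In particular, if ε₁ I ≤ G_0(t, t+k) ≤ ε₂ I for some ε₁, ε₂ > 0, then ε₁ (1+α)^{-4k} I ≤ G_α(t, t+k) ≤ ε₂ I, and G_α(t, t+k) is invertible. -/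
open Matrix

/-- The α-weighted controllability Gramian on ℤ:
`G_α(t,T) = Σ_{s=t}^{T-1} (1+α)^{-4(s-t)} Φ(t,s+1) B(s) B(s)ᵀ Φ(t,s+1)ᵀ`. -/
noncomputable def dGram {n m : ℕ} (Φ : ℤ → ℤ → Matrix (Fin n) (Fin n) ℝ)
    (B : ℤ → Matrix (Fin n) (Fin m) ℝ) (α : ℝ) (t T : ℤ) : Matrix (Fin n) (Fin n) ℝ :=
  ∑ s ∈ Finset.Ico t T,
    ((1 + α) ^ (-(4 * (s - t))) : ℝ) • (Φ t (s+1) * B s * (B s)ᵀ * (Φ t (s+1))ᵀ)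

/-- A nonnegatively weighted sum of positive semidefinite matrices is monotone in the weights. -/
theorem Matrix.PosSemidef.sum_smul_sub_sum_smul {ι κ : Type*} (S : Finset ι)
    {a b : ι → ℝ} {M : ι → Matrix κ κ ℝ} (hM : ∀ i ∈ S, (M i).PosSemidef)
    (hab : ∀ i ∈ S, a i ≤ b i) :
    (∑ i ∈ S, b i • M i - ∑ i ∈ S, a i • M i).PosSemidef := by
  rw [← Finset.sum_sub_distrib]
  refine Matrix.posSemidef_sum S fun i hi => ?_
  rw [← sub_smul]
  exact (hM i hi).smul (sub_nonneg.2 (hab i hi))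

theorem dGram_term_posSemidef {n m : ℕ} (P : Matrix (Fin n) (Fin n) ℝ)
    (Q : Matrix (Fin n) (Fin m) ℝ) : (P * Q * Qᵀ * Pᵀ).PosSemidef := by
  have h := Matrix.posSemidef_self_mul_conjTranspose (P * Q)
  rwa [Matrix.conjTranspose_eq_transpose_of_trivial, Matrix.transpose_mul,
    ← Matrix.mul_assoc] at h

theorem smul_dGram_zero {n m : ℕ} (Φ : ℤ → ℤ → Matrix (Fin n) (Fin n) ℝ)
    (B : ℤ → Matrix (Fin n) (Fin m) ℝ) (c : ℝ) (t T : ℤ) :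
    c • dGram Φ B 0 t T =
      ∑ s ∈ Finset.Ico t T, c • (Φ t (s+1) * B s * (B s)ᵀ * (Φ t (s+1))ᵀ) := by
  simp [dGram, Finset.smul_sum]

theorem dGram_sub_smul_dGram_zero_posSemidef {n m : ℕ}
    (Φ : ℤ → ℤ → Matrix (Fin n) (Fin n) ℝ) (B : ℤ → Matrix (Fin n) (Fin m) ℝ)
    {α : ℝ} (hα : 0 ≤ α) (t k : ℤ) :
    (dGram Φ B α t (t + k) - ((1 + α) ^ (-(4 * k)) : ℝ) • dGram Φ B 0 t (t + k)).PosSemidef := by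
  rw [smul_dGram_zero, dGram]
  refine Matrix.PosSemidef.sum_smul_sub_sum_smul _ (fun s _ => dGram_term_posSemidef _ _)
    fun s hs => ?_
  rw [Finset.mem_Ico] at hs
  exact zpow_le_zpow_right₀ (by linarith) (by lia)

theorem dGram_zero_sub_dGram_posSemidef {n m : ℕ}
    (Φ : ℤ → ℤ → Matrix (Fin n) (Fin n) ℝ) (B : ℤ → Matrix (Fin n) (Fin m) ℝ)
    {α : ℝ} (hα : 0 ≤ α) (t T : ℤ) :
    (dGram Φ B 0 t T - dGram Φ B α t T).PosSemidef := by
  rw [← one_smul ℝ (dGram Φ B 0 t T), smul_dGram_zero, dGram]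
  refine Matrix.PosSemidef.sum_smul_sub_sum_smul _ (fun s _ => dGram_term_posSemidef _ _)
    fun s hs => ?_
  rw [Finset.mem_Ico] at hs
  exact zpow_le_one_of_nonpos₀ (by linarith) (by lia)

/-- Weighted versus unweighted Gramian comparison (discrete case): in the Loewner order,
`(1+α)^{-4k} G₀(t,t+k) ≤ G_α(t,t+k) ≤ G₀(t,t+k)`; and if ε₁I ≤ G₀(t,t+k) ≤ ε₂I with
ε₁, ε₂ > 0 then ε₁(1+α)^{-4k} I ≤ G_α(t,t+k) ≤ ε₂I and G_α(t,t+k) is invertible. -/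
theorem weighted_vs_unweighted_gramian_comparison_discrete {n m : ℕ}
    (A : ℤ → Matrix (Fin n) (Fin n) ℝ) (B : ℤ → Matrix (Fin n) (Fin m) ℝ)
    (hreg : ∀ t : ℤ, IsUnit (1 + A t))
    (Φ : ℤ → ℤ → Matrix (Fin n) (Fin n) ℝ)
    (hΦ0 : ∀ s : ℤ, Φ s s = 1)
    (hΦrec : ∀ t s : ℤ, Φ (t+1) s = (1 + A t) * Φ t s)
    (α : ℝ) (hα : 0 < α) (k : ℕ) (hk : 1 ≤ k) :
    ∀ t : ℤ,
      (dGram Φ B α t (t + k) -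
        ((1 + α) ^ (-(4 * (k : ℤ))) : ℝ) • dGram Φ B 0 t (t + k)).PosSemidef ∧
      (dGram Φ B 0 t (t + k) - dGram Φ B α t (t + k)).PosSemidef ∧
      (∀ ε₁ ε₂ : ℝ, 0 < ε₁ → 0 < ε₂ →
        (dGram Φ B 0 t (t + k) - ε₁ • (1 : Matrix (Fin n) (Fin n) ℝ)).PosSemidef →
        (ε₂ • (1 : Matrix (Fin n) (Fin n) ℝ) - dGram Φ B 0 t (t + k)).PosSemidef →
        ((dGram Φ B α t (t + k) -
            (ε₁ * (1 + α) ^ (-(4 * (k : ℤ)))) • (1 : Matrix (Fin n) (Fin n) ℝ)).PosSemidef ∧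
          (ε₂ • (1 : Matrix (Fin n) (Fin n) ℝ) - dGram Φ B α t (t + k)).PosSemidef ∧
          IsUnit (dGram Φ B α t (t + k)))) := by
  intro t
  have lower := dGram_sub_smul_dGram_zero_posSemidef Φ B hα.le t k
  have upper := dGram_zero_sub_dGram_posSemidef Φ B hα.le t (t + k)
  refine ⟨lower, upper, fun ε₁ ε₂ hε₁ _ h₁ h₂ => ?_⟩
  have hc : 0 < (1 + α) ^ (-(4 * (k : ℤ))) := zpow_pos (by linarith) _
  have bound : (dGram Φ B α t (t + k) -
      (ε₁ * (1 + α) ^ (-(4 * (k : ℤ)))) • (1 : Matrix (Fin n) (Fin n) ℝ)).PosSemidef := by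
    convert lower.add (h₁.smul hc.le) using 1
    rw [smul_sub, smul_smul, mul_comm ε₁]
    abel
  refine ⟨bound, ?_, ?_⟩
  · convert h₂.add upper using 1
    abel
  · have hpos := Matrix.PosDef.posSemidef_add bound
      ((Matrix.PosDef.one (n := Fin n) (R := ℝ)).smul (mul_pos hε₁ hc))
    rw [sub_add_cancel] at hpos
    exact hpos.isUnit
end
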